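/- arXiv:1212.1583 — 2 statements merged into one kernel-verified Lean document; each statement's English description precedes it below -/
import Mathlib

section
/- Let W be a random variable whose characteristic function is z ↦ exp(−|z|^α Γ(1−α)(cos(πα/2) + i sin(πα/2) sign(z))) for some α ∈ (1,2). Then for every 0 < r < α, E|W|^r = (2Γ(r+1)/(πr)) sin(rπ/2) Γ(1 − r/α) |Γ(1−α)|^{r/α} cos(πr/2 − πr/α). In particular, E|W| = (2/π) Γ(1 − 1/α) |Γ(1−α)|^{1/α} sin(π/α). -/
open MeasureTheory Filter Real
open Set ProbabilityTheory Topology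

lemma integrableOn_rpow_mul_exp_neg_mul {a t : ℝ} (ha : 0 < a) (ht : 0 < t) :
    IntegrableOn (fun u : ℝ ↦ u ^ (a - 1) * rexp (-(t * u))) (Ioi 0) := by
  simpa using integrableOn_rpow_mul_exp_neg_mul_rpow (p := 1) (s := a - 1) (by linarith)
    one_pos ht

lemma integrableOn_rpow_smul_cexp_neg_mul {a : ℝ} (ha : 0 < a) {z : ℂ} (hz : 0 < z.re) :
    IntegrableOn (fun u : ℝ ↦ u ^ (a - 1) • Complex.exp (-(z * u))) (Ioi 0) := by
  refine (integrableOn_rpow_mul_exp_neg_mul ha hz).mono' ?_ ?_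
  · exact Measurable.aestronglyMeasurable (by fun_prop)
  · filter_upwards [ae_restrict_mem measurableSet_Ioi] with u hu
    rw [norm_smul, Real.norm_of_nonneg (rpow_nonneg (le_of_lt hu) _), Complex.norm_exp]
    simp

/-- The Laplace transform of `u ↦ u ^ (a - 1)` on the right half-plane. -/
lemma integral_rpow_smul_cexp_neg_mul_Ioi {a : ℝ} (ha : 0 < a) {z : ℂ} (hz : 0 < z.re) :
    ∫ u in Ioi (0 : ℝ), u ^ (a - 1) • Complex.exp (-(z * u)) = z ^ (-a : ℂ) * Gamma a := by
  let μ : Measure ℝ :=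
    (volume.restrict (Ioi 0)).withDensity fun u ↦ ENNReal.ofReal (u ^ (a - 1))
  let X : ℝ → ℝ := fun u ↦ -u
  have hmgf (w : ℂ) :
      complexMGF X μ w = ∫ u in Ioi (0 : ℝ), u ^ (a - 1) • Complex.exp (-(w * u)) := by
    rw [complexMGF, integral_withDensity_eq_integral_toReal_smul (by fun_prop) (by simp)]
    refine setIntegral_congr_fun measurableSet_Ioi fun u hu ↦ ?_
    simp [X, ENNReal.toReal_ofReal (rpow_nonneg (le_of_lt hu) (a - 1))]
  have hset : Ioi (0 : ℝ) ⊆ interior (integrableExpSet X μ) := by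
    refine interior_maximal (fun t ht ↦ ?_) isOpen_Ioi
    change Integrable _ _
    rw [integrable_withDensity_iff_integrable_smul' (by fun_prop) (by simp)]
    refine (integrableOn_rpow_mul_exp_neg_mul ha ht).congr_fun (fun u hu ↦ ?_) measurableSet_Ioi
    simp [X, ENNReal.toReal_ofReal (rpow_nonneg (le_of_lt hu) (a - 1))]
  let U : Set ℂ := {w | 0 < w.re}
  have hU : IsOpen U := isOpen_lt continuous_const Complex.continuous_re
  have hf : AnalyticOnNhd ℂ (complexMGF X μ) U :=
    analyticOnNhd_complexMGF.mono fun w hw ↦ hset hw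
  have hg : AnalyticOnNhd ℂ (fun w : ℂ ↦ w ^ (-a : ℂ) * Gamma a) U := by
    refine DifferentiableOn.analyticOnNhd (fun w hw ↦ ?_) hU
    have : w ∈ Complex.slitPlane := Or.inl hw
    exact ((differentiableAt_id.cpow_const this).mul_const _).differentiableWithinAt
  have hreal (t : ℝ) (ht : 0 < t) :
      complexMGF X μ t = (t : ℂ) ^ (-a : ℂ) * Gamma a := by
    have h := Complex.integral_cpow_mul_exp_neg_mul_Ioi (a := a) (by simpa using ha) ht
    have harg : (t : ℂ).arg ≠ π := by
      simp [Complex.arg_ofReal_of_nonneg ht.le, pi_ne_zero.symm]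
    rw [one_div, Complex.inv_cpow _ _ harg] at h
    rw [hmgf, Complex.cpow_neg, ← Complex.Gamma_ofReal, ← h]
    refine setIntegral_congr_fun measurableSet_Ioi fun u hu ↦ ?_
    simp [Complex.ofReal_cpow (le_of_lt hu)]
  have hfreq : ∃ᶠ w in 𝓝[≠] (1 : ℂ), complexMGF X μ w = w ^ (-a : ℂ) * Gamma a := by
    have ht : Tendsto (fun t : ℝ ↦ (t : ℂ)) (𝓝[>] 1) (𝓝[≠] 1) := by
      refine tendsto_nhdsWithin_iff.2 ⟨?_, ?_⟩
      · exact (Complex.continuous_ofReal.tendsto' 1 1 (by simp)).mono_left nhdsWithin_le_nhds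
      · filter_upwards [self_mem_nhdsWithin] with t ht
        simpa using ht.ne'
    refine ht.frequently (Eventually.frequently ?_)
    filter_upwards [self_mem_nhdsWithin] with t ht
    exact hreal t (one_pos.trans ht)
  rw [← hmgf]
  exact hf.eqOn_of_preconnected_of_frequently_eq hg
    (convex_halfSpace_re_gt 0).isPreconnected (by simp [U]) hfreq hz

lemma norm_one_sub_cexp_neg_le {z : ℂ} (hz : 0 ≤ z.re) :
    ‖1 - Complex.exp (-z)‖ ≤ min 2 (2 * ‖z‖) := by
  have h2 : ‖1 - Complex.exp (-z)‖ ≤ 2 := by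
    refine (norm_sub_le _ _).trans ?_
    have : ‖Complex.exp (-z)‖ ≤ 1 := by simpa [Complex.norm_exp] using hz
    rw [norm_one]
    linarith
  refine le_min h2 ?_
  rcases le_total ‖z‖ 1 with h | h
  · rw [norm_sub_rev]
    simpa using Complex.norm_exp_sub_one_le (x := -z) (by simpa using h)
  · linarith

lemma integrableOn_Ioi_rpow_smul_of_norm_le {E : Type*} [NormedAddCommGroup E] [NormedSpace ℝ E]
    {f : ℝ → E} (hf : AEStronglyMeasurable f (volume.restrict (Ioi 0))) {r p C D : ℝ}
    (hr : 0 < r) (hrp : r < p) (h1 : ∀ t > 0, ‖f t‖ ≤ C) (h2 : ∀ t > 0, ‖f t‖ ≤ D * t ^ p) :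
    IntegrableOn (fun t : ℝ ↦ t ^ (-r - 1) • f t) (Ioi 0) := by
  have hm : AEStronglyMeasurable (fun t : ℝ ↦ t ^ (-r - 1) • f t) (volume.restrict (Ioi 0)) :=
    AEStronglyMeasurable.smul (Measurable.aestronglyMeasurable (by fun_prop)) hf
  rw [← Ioc_union_Ioi_eq_Ioi (zero_le_one' ℝ), integrableOn_union]
  constructor
  · have hi : IntegrableOn (fun t : ℝ ↦ D * t ^ (p - r - 1)) (Ioc 0 1) := by
      rw [← intervalIntegrable_iff_integrableOn_Ioc_of_le zero_le_one]
      exact (intervalIntegral.intervalIntegrable_rpow' (by linarith)).const_mul D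
    refine hi.mono' (hm.mono_set Ioc_subset_Ioi_self) ?_
    filter_upwards [ae_restrict_mem measurableSet_Ioc] with t ht
    rw [norm_smul, Real.norm_of_nonneg (rpow_nonneg ht.1.le _),
      show p - r - 1 = (-r - 1) + p by ring, rpow_add ht.1, mul_left_comm]
    exact mul_le_mul_of_nonneg_left (h2 t ht.1) (rpow_nonneg ht.1.le _)
  · have hi : IntegrableOn (fun t : ℝ ↦ t ^ (-r - 1) * C) (Ioi 1) :=
      (integrableOn_Ioi_rpow_of_lt (by linarith) one_pos).mul_const C
    refine hi.mono' (hm.mono_set (Ioi_subset_Ioi zero_le_one)) ?_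
    filter_upwards [ae_restrict_mem measurableSet_Ioi] with t ht
    have ht' : 0 < t := one_pos.trans ht
    rw [norm_smul, Real.norm_of_nonneg (rpow_nonneg ht'.le _)]
    exact mul_le_mul_of_nonneg_left (h1 t ht') (rpow_nonneg ht'.le _)

lemma integrableOn_rpow_smul_one_sub_cexp {r p : ℝ} (hr : 0 < r) (hrp : r < p) {z : ℂ}
    (hz : 0 ≤ z.re) :
    IntegrableOn (fun t : ℝ ↦ t ^ (-r - 1) • (1 - Complex.exp (-(z * (t ^ p : ℝ))))) (Ioi 0) := by
  have hre (t : ℝ) (ht : 0 < t) : 0 ≤ (z * (t ^ p : ℝ)).re := by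
    rw [Complex.re_mul_ofReal]
    positivity
  refine integrableOn_Ioi_rpow_smul_of_norm_le (C := 2) (D := 2 * ‖z‖)
    (Measurable.aestronglyMeasurable (by fun_prop)) hr hrp (fun t ht ↦ ?_) (fun t ht ↦ ?_)
  · exact (norm_one_sub_cexp_neg_le (hre t ht)).trans (min_le_left _ _)
  · refine (norm_one_sub_cexp_neg_le (hre t ht)).trans ((min_le_right _ _).trans_eq ?_)
    rw [norm_mul, Complex.norm_real, Real.norm_of_nonneg (rpow_nonneg ht.le p), mul_assoc]

lemma integral_rpow_smul_one_sub_cexp_neg_mul {s : ℝ} (hs : 0 < s) (hs1 : s < 1) {z : ℂ}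
    (hz : 0 < z.re) :
    ∫ u in Ioi (0 : ℝ), u ^ (-s - 1) • (1 - Complex.exp (-(z * u))) =
      (Gamma (1 - s) / s : ℝ) * z ^ (s : ℂ) := by
  have hz0 : z ≠ 0 := by rintro rfl; simp at hz
  have hs0 : (s : ℂ) ≠ 0 := by exact_mod_cast hs.ne'
  let u : ℝ → ℂ := fun t ↦ 1 - Complex.exp (-(z * t))
  let u' : ℝ → ℂ := fun t ↦ z * Complex.exp (-(z * t))
  let v : ℝ → ℂ := fun t ↦ ((-s⁻¹ * t ^ (-s) : ℝ) : ℂ)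
  let v' : ℝ → ℂ := fun t ↦ ((t ^ (-s - 1) : ℝ) : ℂ)
  have hu : ∀ t ∈ Ioi (0 : ℝ), HasDerivAt u (u' t) t := by
    intro t _
    have h1 : HasDerivAt (fun t : ℝ ↦ -(z * (t : ℂ))) (-(z * 1)) t :=
      ((Complex.ofRealCLM.hasDerivAt (x := t)).const_mul z).neg
    refine (h1.cexp.const_sub 1).congr_deriv ?_
    simp only [u']
    ring
  have hv : ∀ t ∈ Ioi (0 : ℝ), HasDerivAt v (v' t) t := by
    intro t ht
    refine HasDerivAt.ofReal_comp ?_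
    refine ((hasDerivAt_rpow_const (p := -s) (Or.inl (ne_of_gt ht))).const_mul (-s⁻¹)).congr_deriv
      ?_
    field_simp
  have hbound (t : ℝ) (ht : 0 < t) :
      ‖(u * v) t‖ ≤ 2 * s⁻¹ * t ^ (-s) ∧ ‖(u * v) t‖ ≤ 2 * ‖z‖ * s⁻¹ * t ^ (1 - s) := by
    have hv : ‖v t‖ = s⁻¹ * t ^ (-s) := by
      simp only [v, Complex.norm_real, norm_mul, norm_neg]
      rw [Real.norm_of_nonneg (by positivity), Real.norm_of_nonneg (by positivity)]
    have hu : ‖u t‖ ≤ min 2 (2 * ‖z * t‖) :=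
      norm_one_sub_cexp_neg_le (by rw [Complex.re_mul_ofReal]; positivity)
    rw [Pi.mul_apply, norm_mul, hv]
    constructor
    · rw [mul_assoc]
      exact mul_le_mul_of_nonneg_right (hu.trans (min_le_left _ _)) (by positivity)
    · refine (mul_le_mul_of_nonneg_right (hu.trans (min_le_right _ _)) (by positivity)).trans_eq ?_
      rw [norm_mul, Complex.norm_real, Real.norm_of_nonneg ht.le, sub_eq_add_neg, rpow_add ht,
        rpow_one]
      ring
  have h_zero : Tendsto (u * v) (𝓝[>] 0) (𝓝 0) := by
    have h : Tendsto (fun t : ℝ ↦ 2 * ‖z‖ * s⁻¹ * t ^ (1 - s)) (𝓝[>] 0) (𝓝 0) := by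
      have := (continuous_rpow_const (q := 1 - s) (by linarith)).tendsto 0
      rw [zero_rpow (by linarith)] at this
      simpa using (this.mono_left nhdsWithin_le_nhds).const_mul (2 * ‖z‖ * s⁻¹)
    refine squeeze_zero_norm' ?_ h
    filter_upwards [self_mem_nhdsWithin] with t ht using (hbound t ht).2
  have h_infty : Tendsto (u * v) atTop (𝓝 0) := by
    have h : Tendsto (fun t : ℝ ↦ 2 * s⁻¹ * t ^ (-s)) atTop (𝓝 0) := by
      simpa using (tendsto_rpow_neg_atTop hs).const_mul (2 * s⁻¹)
    refine squeeze_zero_norm' ?_ h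
    filter_upwards [eventually_gt_atTop 0] with t ht using (hbound t ht).1
  have h_int : IntegrableOn (u * v') (Ioi 0) := by
    refine (integrableOn_rpow_smul_one_sub_cexp hs hs1 hz.le).congr_fun (fun t _ ↦ ?_)
      measurableSet_Ioi
    simp [u, v', mul_comm]
  have h_int' : IntegrableOn (u' * v) (Ioi 0) := by
    have h : IntegrableOn (fun t : ℝ ↦ -(z / s) * t ^ ((1 - s) - 1) • Complex.exp (-(z * t)))
        (Ioi 0) :=
      (integrableOn_rpow_smul_cexp_neg_mul (by linarith) hz).const_mul _
    refine h.congr_fun (fun t _ ↦ ?_) measurableSet_Ioi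
    simp [u', v]
    ring
  have key := integral_Ioi_mul_deriv_eq_deriv_mul hu hv h_int h_int' h_zero h_infty
  calc ∫ t in Ioi (0 : ℝ), t ^ (-s - 1) • (1 - Complex.exp (-(z * t)))
      = ∫ t in Ioi (0 : ℝ), u t * v' t := by
        simp [u, v', mul_comm]
    _ = (z / s) * ∫ t in Ioi (0 : ℝ), t ^ ((1 - s) - 1) • Complex.exp (-(z * t)) := by
        rw [key, sub_self, zero_sub, ← integral_neg, ← integral_const_mul]
        congr 1 with t
        simp [u', v]
        ring
    _ = (Gamma (1 - s) / s : ℝ) * z ^ (s : ℂ) := by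
        rw [integral_rpow_smul_cexp_neg_mul_Ioi (by linarith) hz]
        have : z ^ (s : ℂ) = z * z ^ (-((1 - s : ℝ) : ℂ)) := by
          nth_rewrite 2 [← Complex.cpow_one z]
          rw [← Complex.cpow_add _ _ hz0]
          push_cast
          ring_nf
        rw [this]
        push_cast
        ring

lemma integral_rpow_smul_one_sub_cexp_neg_mul_rpow {r p : ℝ} (hr : 0 < r) (hrp : r < p) {z : ℂ}
    (hz : 0 < z.re) :
    ∫ t in Ioi (0 : ℝ), t ^ (-r - 1) • (1 - Complex.exp (-(z * (t ^ p : ℝ)))) =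
      (Gamma (1 - r / p) / r : ℝ) * z ^ ((r / p : ℝ) : ℂ) := by
  have hp : 0 < p := hr.trans hrp
  have h := integral_rpow_smul_one_sub_cexp_neg_mul (div_pos hr hp) ((div_lt_one hp).2 hrp) hz
  rw [← integral_comp_rpow_Ioi_of_pos hp] at h
  have hcongr : ∀ t ∈ Ioi (0 : ℝ), (p * t ^ (p - 1)) • (t ^ p) ^ (-(r / p) - 1) •
      (1 - Complex.exp (-(z * (t ^ p : ℝ)))) =
      p • t ^ (-r - 1) • (1 - Complex.exp (-(z * (t ^ p : ℝ)))) := by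
    intro t ht
    have hpow : t ^ (p - 1) * (t ^ p) ^ (-(r / p) - 1) = t ^ (-r - 1) := by
      rw [← rpow_mul (le_of_lt ht), ← rpow_add ht]
      congr 1
      field_simp
      ring
    rw [mul_smul, smul_smul (t ^ (p - 1)), hpow]
  rw [setIntegral_congr_fun measurableSet_Ioi hcongr, integral_smul] at h
  rw [← inv_smul_smul₀ hp.ne' (∫ t in Ioi (0 : ℝ), _), h, Complex.real_smul]
  have : (p : ℂ) ≠ 0 := by exact_mod_cast hp.ne'
  have : (r : ℂ) ≠ 0 := by exact_mod_cast hr.ne'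
  push_cast
  field_simp

lemma integral_rpow_mul_one_sub_re_cexp {r p : ℝ} (hr : 0 < r) (hrp : r < p) {z : ℂ}
    (hz : 0 < z.re) :
    ∫ t in Ioi (0 : ℝ), t ^ (-r - 1) * (1 - (Complex.exp (-(z * (t ^ p : ℝ)))).re) =
      Gamma (1 - r / p) / r * (z ^ ((r / p : ℝ) : ℂ)).re := by
  rw [← Complex.re_ofReal_mul, ← integral_rpow_smul_one_sub_cexp_neg_mul_rpow hr hrp hz]
  rw [← RCLike.re_eq_complex_re, ← integral_re (integrableOn_rpow_smul_one_sub_cexp hr hrp hz.le)]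
  simp

lemma integrableOn_rpow_mul_one_sub_cos {r : ℝ} (hr : 0 < r) (hr2 : r < 2) (x : ℝ) :
    IntegrableOn (fun t : ℝ ↦ t ^ (-r - 1) * (1 - cos (t * x))) (Ioi 0) := by
  refine integrableOn_Ioi_rpow_smul_of_norm_le (C := 2) (D := x ^ 2 / 2)
    (Measurable.aestronglyMeasurable (by fun_prop)) hr hr2 (fun t _ ↦ ?_) (fun t _ ↦ ?_)
  all_goals rw [Real.norm_of_nonneg (sub_nonneg.2 (cos_le_one _))]
  · linarith [neg_one_le_cos (t * x)]
  · rw [rpow_two]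
    linarith [one_sub_sq_div_two_le_cos (x := t * x), mul_pow t x 2]

lemma integral_rpow_mul_one_sub_cos {r : ℝ} (hr : 0 < r) (x : ℝ) :
    ∫ t in Ioi (0 : ℝ), t ^ (-r - 1) * (1 - cos (t * x)) =
      |x| ^ r * ∫ t in Ioi (0 : ℝ), t ^ (-r - 1) * (1 - cos t) := by
  rcases eq_or_ne x 0 with rfl | hx
  · simp [zero_rpow hr.ne']
  have hx' : 0 < |x| := abs_pos.2 hx
  have h := integral_comp_mul_left_Ioi' (fun t ↦ t ^ (-r - 1) * (1 - cos t)) 0 hx'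
  rw [mul_zero] at h
  rw [← h, smul_eq_mul, ← integral_const_mul, ← integral_const_mul]
  refine setIntegral_congr_fun measurableSet_Ioi fun t ht ↦ ?_
  have hcos : cos (|x| * t) = cos (t * x) := by
    rw [← cos_abs (t * x), abs_mul, abs_of_pos (mem_Ioi.1 ht), mul_comm]
  have hpow : |x| ^ r * (|x| * |x| ^ (-r - 1)) = 1 := by
    rw [mul_comm |x|, ← rpow_add_one hx'.ne', ← rpow_add hx']
    simp
  simp only [hcos]
  rw [mul_rpow hx'.le (le_of_lt ht)]
  linear_combination (-(t ^ (-r - 1) * (1 - cos (t * x)))) * hpow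

/-- Absolute moments in terms of the real part of the characteristic function, up to the
normalising constant. -/
lemma integral_abs_rpow_mul_eq {Ω : Type*} [MeasurableSpace Ω] (P : Measure Ω)
    [IsProbabilityMeasure P] {X : Ω → ℝ} (hX : Measurable X) {φ : ℝ → ℝ}
    (hφ : ∀ t > 0, ∫ ω, cos (t * X ω) ∂P = φ t) {r : ℝ} (hr : 0 < r) (hr2 : r < 2) :
    (∫ ω, |X ω| ^ r ∂P) * ∫ t in Ioi (0 : ℝ), t ^ (-r - 1) * (1 - cos t) =
      ∫ t in Ioi (0 : ℝ), t ^ (-r - 1) * (1 - φ t) := by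
  have hcos (t : ℝ) : Integrable (fun ω ↦ cos (t * X ω)) P :=
    Integrable.of_bound (Measurable.aestronglyMeasurable (by fun_prop)) 1
      (ae_of_all _ fun ω ↦ abs_cos_le_one _)
  have h_int (t : ℝ) (ht : 0 < t) :
      ∫ ω, t ^ (-r - 1) * (1 - cos (t * X ω)) ∂P = t ^ (-r - 1) * (1 - φ t) := by
    rw [integral_const_mul, integral_sub (integrable_const _) (hcos t), hφ t ht]
    simp
  have hnn (t : ℝ) (ht : t ∈ Ioi (0 : ℝ)) (x : ℝ) : 0 ≤ t ^ (-r - 1) * (1 - cos (t * x)) :=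
    mul_nonneg (rpow_nonneg (le_of_lt ht) _) (sub_nonneg.2 (cos_le_one _))
  have hnn' (x : ℝ) :
      0 ≤ᵐ[volume.restrict (Ioi (0 : ℝ))] fun t ↦ t ^ (-r - 1) * (1 - cos (t * x)) := by
    filter_upwards [ae_restrict_mem measurableSet_Ioi] with t ht using hnn t ht x
  rw [← integral_mul_const]
  simp_rw [← integral_rpow_mul_one_sub_cos hr]
  rw [← setIntegral_congr_fun measurableSet_Ioi h_int]
  rw [integral_eq_lintegral_of_nonneg_ae (ae_of_all _ fun ω ↦ integral_nonneg_of_ae (hnn' _)),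
    integral_eq_lintegral_of_nonneg_ae]
  · congr 1
    calc ∫⁻ ω, ENNReal.ofReal (∫ t in Ioi (0 : ℝ), t ^ (-r - 1) * (1 - cos (t * X ω))) ∂P
        = ∫⁻ ω, (∫⁻ t in Ioi (0 : ℝ),
            ENNReal.ofReal (t ^ (-r - 1) * (1 - cos (t * X ω)))) ∂P := by
          simp_rw [ofReal_integral_eq_lintegral_ofReal
            (integrableOn_rpow_mul_one_sub_cos hr hr2 _) (hnn' _)]
      _ = ∫⁻ t in Ioi (0 : ℝ), ∫⁻ ω,
            ENNReal.ofReal (t ^ (-r - 1) * (1 - cos (t * X ω))) ∂P := by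
          rw [lintegral_lintegral_swap]
          exact Measurable.aemeasurable (by fun_prop)
      _ = ∫⁻ t in Ioi (0 : ℝ),
            ENNReal.ofReal (∫ ω, t ^ (-r - 1) * (1 - cos (t * X ω)) ∂P) := by
          refine setLIntegral_congr_fun measurableSet_Ioi fun t ht ↦ ?_
          have hi : Integrable (fun ω ↦ t ^ (-r - 1) * (1 - cos (t * X ω))) P :=
            ((integrable_const _).sub (hcos t)).const_mul _
          rw [ofReal_integral_eq_lintegral_ofReal hi (ae_of_all _ fun ω ↦ hnn t ht _)]
  · filter_upwards [ae_restrict_mem measurableSet_Ioi] with t ht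
      using integral_nonneg fun ω ↦ hnn t ht _
  · refine (StronglyMeasurable.integral_prod_right' (f := fun q : ℝ × Ω ↦
      q.1 ^ (-r - 1) * (1 - cos (q.1 * X q.2))) ?_).aestronglyMeasurable
    exact Measurable.stronglyMeasurable (by fun_prop)
  · simp_rw [integral_rpow_mul_one_sub_cos hr]
    exact Measurable.aestronglyMeasurable (by fun_prop)

lemma integral_abs_rpow_gaussianReal_two {r : ℝ} (hr : -1 < r) :
    ∫ x, |x| ^ r ∂(gaussianReal 0 2) = 2 ^ r * Gamma ((r + 1) / 2) / √π := by
  rw [integral_gaussianReal_eq_integral_smul (by norm_num)]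
  have h (x : ℝ) : gaussianPDFReal 0 2 x • |x| ^ r =
      (√(2 * π * 2))⁻¹ * (|x| ^ r * rexp (-(1 / 4) * |x| ^ (2 : ℝ))) := by
    simp only [gaussianPDFReal, smul_eq_mul, rpow_two, sq_abs]
    push_cast
    ring_nf
  simp_rw [h]
  rw [integral_const_mul, integral_comp_abs (f := fun x ↦ x ^ r * rexp (-(1 / 4) * x ^ (2 : ℝ))),
    integral_rpow_mul_exp_neg_mul_rpow two_pos hr (by norm_num)]
  have h4 : (1 / 4 : ℝ) ^ (-(r + 1) / 2) = 2 * 2 ^ r := by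
    rw [show (1 / 4 : ℝ) = 2 ^ (-2 : ℝ) by rw [rpow_neg two_pos.le, rpow_two]; norm_num,
      ← rpow_mul two_pos.le, show -2 * (-(r + 1) / 2) = r + 1 by ring, rpow_add_one two_ne_zero]
    ring
  have hs : √(2 * π * 2) = 2 * √π := by
    rw [show 2 * π * 2 = 2 ^ 2 * π by ring, sqrt_mul (by positivity), sqrt_sq two_pos.le]
  rw [h4, hs]
  field_simp

/-- The normalising constant of the moment formula, computed from the Gaussian case. -/
lemma integral_rpow_mul_one_sub_cos_eq {r : ℝ} (hr : 0 < r) (hr2 : r < 2) :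
    ∫ t in Ioi (0 : ℝ), t ^ (-r - 1) * (1 - cos t) = π / (2 * Gamma (r + 1) * sin (r * π / 2)) := by
  have hφ : ∀ t > 0, ∫ x, cos (t * x) ∂(gaussianReal 0 2) =
      (Complex.exp (-((1 : ℂ) * (t ^ (2 : ℝ) : ℝ)))).re := by
    intro t _
    have h := congrArg Complex.re (charFun_gaussianReal (μ := 0) (v := 2) t)
    rw [charFun_apply_real, ← RCLike.re_eq_complex_re, ← integral_re] at h
    · convert h using 1
      · congr with x
        rw [RCLike.re_eq_complex_re, ← Complex.ofReal_mul, Complex.exp_ofReal_mul_I_re]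
      · simp
    · refine Integrable.of_bound (Measurable.aestronglyMeasurable (by fun_prop)) 1
        (ae_of_all _ fun x ↦ ?_)
      rw [← Complex.ofReal_mul, Complex.norm_exp_ofReal_mul_I]
  have h := integral_abs_rpow_mul_eq (gaussianReal 0 2) measurable_id hφ hr hr2
  rw [integral_rpow_mul_one_sub_re_cexp hr hr2 (by simp)] at h
  simp only [id, integral_abs_rpow_gaussianReal_two (by linarith : -1 < r), Complex.one_cpow,
    Complex.one_re, mul_one] at h
  have hsin : 0 < sin (r * π / 2) :=
    sin_pos_of_pos_of_lt_pi (by positivity) (by nlinarith [pi_pos])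
  have hdup := Gamma_mul_Gamma_add_half (r / 2)
  have hrefl := Gamma_mul_Gamma_one_sub (r / 2)
  rw [show r / 2 + 1 / 2 = (r + 1) / 2 by ring, show 2 * (r / 2) = r by ring,
    rpow_sub two_pos, rpow_one] at hdup
  rw [show π * (r / 2) = r * π / 2 by ring] at hrefl
  have g1 : 0 < Gamma (r / 2) := Gamma_pos_of_pos (by positivity)
  have g2 : 0 < Gamma ((r + 1) / 2) := Gamma_pos_of_pos (by positivity)
  have g3 : 0 < Gamma r := Gamma_pos_of_pos hr
  have h2 : (0 : ℝ) < 2 ^ r := by positivity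
  have hπ : 0 < √π := sqrt_pos.2 pi_pos
  rw [Gamma_add_one hr.ne']
  rw [eq_div_iff hsin.ne'] at hrefl
  rw [div_mul_eq_mul_div, div_eq_div_iff hπ.ne' hr.ne'] at h
  rw [eq_div_iff (by positivity)]
  rw [mul_div_assoc', div_mul_eq_mul_div, eq_div_iff h2.ne'] at hdup
  generalize (∫ t in Ioi (0 : ℝ), t ^ (-r - 1) * (1 - cos t)) = K at *
  generalize Gamma (r / 2) = A at *
  generalize Gamma ((r + 1) / 2) = B at *
  generalize Gamma (1 - r / 2) = C at *
  generalize Gamma r = G at *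
  generalize sin (r * π / 2) = S at *
  generalize (2 : ℝ) ^ r = T at *
  generalize √π = q at *
  refine mul_right_cancel₀ hπ.ne' ?_
  linear_combination (-(K * r * S)) * hdup + (A * S) * h + q * hrefl

/-- Absolute moments in terms of the real part of the characteristic function. -/
lemma integral_abs_rpow_eq {Ω : Type*} [MeasurableSpace Ω] (P : Measure Ω)
    [IsProbabilityMeasure P] {X : Ω → ℝ} (hX : Measurable X) {φ : ℝ → ℝ}
    (hφ : ∀ t > 0, ∫ ω, cos (t * X ω) ∂P = φ t) {r : ℝ} (hr : 0 < r) (hr2 : r < 2) :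
    ∫ ω, |X ω| ^ r ∂P = 2 * Gamma (r + 1) / π * sin (r * π / 2) *
      ∫ t in Ioi (0 : ℝ), t ^ (-r - 1) * (1 - φ t) := by
  have hsin : 0 < sin (r * π / 2) :=
    sin_pos_of_pos_of_lt_pi (by positivity) (by nlinarith [pi_pos])
  have hG : 0 < Gamma (r + 1) := Gamma_pos_of_pos (by positivity)
  rw [← integral_abs_rpow_mul_eq P hX hφ hr hr2, integral_rpow_mul_one_sub_cos_eq hr hr2]
  field_simp

/-- moments of a spectrally negative `α`-stable random variable `W` with
characteristic function `z ↦ exp(−|z|^α Γ(1−α)(cos(πα/2) + i sin(πα/2) sign z))`. -/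
theorem stable_absolute_moments
    {Ω : Type*} [MeasurableSpace Ω] (P : Measure Ω) [IsProbabilityMeasure P]
    (α : ℝ) (hα : 1 < α) (hα2 : α < 2)
    (W : Ω → ℝ) (hW : Measurable W)
    (hchar : ∀ z : ℝ, ∫ ω, Complex.exp (Complex.I * (z : ℂ) * (W ω : ℂ)) ∂P =
      Complex.exp (-((|z| ^ α * Real.Gamma (1 - α) : ℝ) : ℂ) *
        ((Real.cos (π * α / 2) : ℂ) +
          Complex.I * (Real.sin (π * α / 2) : ℂ) * (Real.sign z : ℂ)))) :
    (∀ r : ℝ, 0 < r → r < α →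
      ∫ ω, |W ω| ^ r ∂P =
        (2 * Real.Gamma (r + 1) / (π * r)) * Real.sin (r * π / 2) *
          Real.Gamma (1 - r / α) * |Real.Gamma (1 - α)| ^ (r / α) *
          Real.cos (π * r / 2 - π * r / α)) ∧
    ∫ ω, |W ω| ∂P =
      (2 / π) * Real.Gamma (1 - 1 / α) * |Real.Gamma (1 - α)| ^ (1 / α) *
        Real.sin (π / α) := by
  have hα0 : 0 < α := by linarith
  have hΓ : Gamma (1 - α) < 0 := by
    have h1 : 0 < Gamma (1 - α + 1) := Gamma_pos_of_pos (by linarith)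
    rw [Gamma_add_one (by linarith)] at h1
    by_contra! h
    nlinarith
  obtain ⟨θ, hθ⟩ : ∃ θ : ℝ, θ = π * α / 2 - π := ⟨_, rfl⟩
  have hθ1 : -(π / 2) < θ := by nlinarith [pi_pos]
  have hθ2 : θ < 0 := by nlinarith [pi_pos]
  have hc : 0 < |Gamma (1 - α)| := abs_pos.2 hΓ.ne
  let z : ℂ := Complex.exp ((log |Gamma (1 - α)| : ℝ) + θ * Complex.I)
  have hz_eq : z = |Gamma (1 - α)| * (cos θ + sin θ * Complex.I) := by
    simp only [z]
    rw [Complex.exp_add, ← Complex.ofReal_exp, exp_log hc, Complex.exp_mul_I]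
    push_cast
    ring
  have hz : 0 < z.re := by
    have : 0 < cos θ := cos_pos_of_mem_Ioo ⟨hθ1, by linarith [pi_pos]⟩
    rw [hz_eq, Complex.re_ofReal_mul]
    simpa [← Complex.ofReal_cos, ← Complex.ofReal_sin] using mul_pos hc this
  have hpow (s : ℝ) : (z ^ (s : ℂ)).re = |Gamma (1 - α)| ^ s * cos (θ * s) := by
    rw [Complex.cpow_def_of_ne_zero (Complex.exp_ne_zero _), Complex.log_exp]
    · rw [Complex.exp_re]
      simp [rpow_def_of_pos hc]
    · simpa using by linarith
    · simpa using by linarith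
  have hφ : ∀ t > 0, ∫ ω, cos (t * W ω) ∂P = (Complex.exp (-(z * (t ^ α : ℝ)))).re := by
    intro t ht
    have h := congrArg Complex.re (hchar t)
    rw [← RCLike.re_eq_complex_re, ← integral_re] at h
    · convert h using 1
      · congr with ω
        rw [RCLike.re_eq_complex_re, mul_assoc, ← Complex.ofReal_mul, mul_comm Complex.I,
          Complex.exp_ofReal_mul_I_re]
      · have h1 : cos θ = -cos (π * α / 2) := by rw [hθ, cos_sub_pi]
        have h2 : sin θ = -sin (π * α / 2) := by rw [hθ, sin_sub_pi]
        rw [RCLike.re_eq_complex_re, hz_eq, h1, h2, abs_of_neg hΓ, abs_of_pos ht, sign_of_pos ht]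
        push_cast
        ring_nf
    · refine Integrable.of_bound (Measurable.aestronglyMeasurable (by fun_prop)) 1
        (ae_of_all _ fun ω ↦ ?_)
      rw [mul_assoc, ← Complex.ofReal_mul, mul_comm Complex.I, Complex.norm_exp_ofReal_mul_I]
  have main : ∀ r : ℝ, 0 < r → r < α →
      ∫ ω, |W ω| ^ r ∂P =
        (2 * Real.Gamma (r + 1) / (π * r)) * Real.sin (r * π / 2) *
          Real.Gamma (1 - r / α) * |Real.Gamma (1 - α)| ^ (r / α) *
          Real.cos (π * r / 2 - π * r / α) := by
    intro r hr hrα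
    rw [integral_abs_rpow_eq P hW hφ hr (hrα.trans hα2),
      integral_rpow_mul_one_sub_re_cexp hr hrα hz, hpow,
      show θ * (r / α) = π * r / 2 - π * r / α by rw [hθ]; field_simp]
    field_simp
  refine ⟨main, ?_⟩
  have h := main 1 one_pos hα
  simp only [rpow_one] at h
  rw [h, show π * 1 / 2 - π * 1 / α = π / 2 - π / α by ring, cos_pi_div_two_sub,
    show (1 : ℝ) * π / 2 = π / 2 by ring, sin_pi_div_two, one_add_one_eq_two, Gamma_two]
  ring
end

section
/- For any α ∈ (1,2) and 0 < r < α, with B = Γ(1−α) cos(πα/2) and C = Γ(1−α) sin(πα/2), the integral identity ∫₀^∞ (1 − e^{−Bu} cos(Cu)) u^{−1−r/α} du = −Γ(−r/α) |Γ(1−α)|^{r/α} cos(πr/2 − πr/α) holds. -/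
open Real Set

open MeasureTheory Filter Topology ProbabilityTheory

theorem integrableOn_rpow_mul_cexp_neg_mul {a : ℝ} (ha : 0 < a) {z : ℂ} (hz : 0 < z.re) :
    IntegrableOn (fun u : ℝ ↦ ((u ^ (a - 1) : ℝ) : ℂ) * Complex.exp (-(z * u))) (Ioi 0) := by
  have h := integrableOn_rpow_mul_exp_neg_mul_rpow (s := a - 1) (p := 1) (b := z.re)
    (by linarith) one_pos hz
  refine Integrable.mono' h (by fun_prop) ?_
  refine ae_restrict_of_forall_mem measurableSet_Ioi fun u hu ↦ ?_
  have hu' : (0 : ℝ) < u := hu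
  rw [norm_mul, Complex.norm_real, Complex.norm_exp, Real.norm_of_nonneg (by positivity)]
  simp

/-- The Gamma integral `∫₀^∞ u^(a-1) e^(-zu) du` for a complex rate `z` in the right half-plane. -/
theorem integral_rpow_mul_cexp_neg_mul_Ioi {a : ℝ} (ha : 0 < a) {z : ℂ} (hz : 0 < z.re) :
    ∫ u in Ioi (0 : ℝ), ((u ^ (a - 1) : ℝ) : ℂ) * Complex.exp (-(z * u)) =
      z ^ (-a : ℂ) * (Real.Gamma a : ℂ) := by
  set μ : Measure ℝ := (volume.restrict (Ioi 0)).withDensity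
    fun u ↦ ENNReal.ofReal (u ^ (a - 1)) with hμ
  have hmeas : Measurable fun u : ℝ ↦ ENNReal.ofReal (u ^ (a - 1)) := by fun_prop
  have hfin : ∀ᵐ u ∂volume.restrict (Ioi (0 : ℝ)), ENNReal.ofReal (u ^ (a - 1)) < ⊤ :=
    ae_of_all _ fun u ↦ ENNReal.ofReal_lt_top
  have hexp : Iio 0 ⊆ integrableExpSet id μ := by
    intro t ht
    have ht' : t < 0 := ht
    rw [integrableExpSet, mem_ofPred_eq, hμ,
      integrable_withDensity_iff hmeas hfin]
    have h := integrableOn_rpow_mul_exp_neg_mul_rpow (s := a - 1) (p := 1) (b := -t)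
      (by linarith) one_pos (by linarith)
    refine h.congr_fun (fun u hu ↦ ?_) measurableSet_Ioi
    have hu' : (0 : ℝ) < u := hu
    simp [ENNReal.toReal_ofReal (rpow_nonneg hu'.le _), mul_comm]
  have hmgf (w : ℂ) : complexMGF id μ w =
      ∫ u in Ioi (0 : ℝ), ((u ^ (a - 1) : ℝ) : ℂ) * Complex.exp (w * u) := by
    rw [complexMGF, hμ, integral_withDensity_eq_integral_toReal_smul hmeas hfin]
    refine setIntegral_congr_fun measurableSet_Ioi fun u hu ↦ ?_
    have hu' : (0 : ℝ) < u := hu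
    simp [ENNReal.toReal_ofReal (rpow_nonneg hu'.le _)]
  have hopen : IsOpen {w : ℂ | w.re < 0} := isOpen_lt Complex.continuous_re continuous_const
  have hG : AnalyticOnNhd ℂ (complexMGF id μ) {w : ℂ | w.re < 0} :=
    analyticOnNhd_complexMGF.mono fun w hw ↦ interior_maximal hexp isOpen_Iio hw
  have hH : AnalyticOnNhd ℂ (fun w : ℂ ↦ (-w) ^ (-a : ℂ) * (Real.Gamma a : ℂ))
      {w : ℂ | w.re < 0} := by
    refine DifferentiableOn.analyticOnNhd (fun w hw ↦ ?_) hopen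
    have hw' : w.re < 0 := hw
    refine DifferentiableAt.differentiableWithinAt (.mul_const (.cpow_const (by fun_prop) ?_) _)
    exact Or.inl (by simpa using hw')
  have hreal : ∀ t : ℝ, t < 0 →
      complexMGF id μ t = (-(t : ℂ)) ^ (-a : ℂ) * (Real.Gamma a : ℂ) := by
    intro t ht
    rw [hmgf]
    have h := Real.integral_rpow_mul_exp_neg_mul_Ioi ha (neg_pos.2 ht)
    rw [one_div, inv_rpow (neg_pos.2 ht).le, ← rpow_neg (neg_pos.2 ht).le] at h
    rw [← Complex.ofReal_neg, ← Complex.ofReal_neg, ← Complex.ofReal_cpow (neg_pos.2 ht).le,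
      ← Complex.ofReal_mul, ← h, ← integral_complex_ofReal]
    simp
  have hfreq : ∃ᶠ w in 𝓝[≠] ((-1 : ℝ) : ℂ),
      complexMGF id μ w = (-w) ^ (-a : ℂ) * (Real.Gamma a : ℂ) := by
    have ht : Tendsto (fun t : ℝ ↦ (t : ℂ)) (𝓝[≠] (-1)) (𝓝[≠] ((-1 : ℝ) : ℂ)) :=
      Complex.continuous_ofReal.continuousWithinAt.tendsto_nhdsWithin fun t ht ↦ by
        simpa using fun h ↦ ht (Complex.ofReal_injective (by simpa using h))
    refine ht.frequently (Eventually.frequently ?_)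
    filter_upwards [nhdsWithin_le_nhds (Iio_mem_nhds (by norm_num : (-1 : ℝ) < 0))] with t ht
    exact hreal t ht
  have hconn : IsPreconnected {w : ℂ | w.re < 0} :=
    (convex_halfSpace_re_lt 0).isPreconnected
  have h := hG.eqOn_of_preconnected_of_frequently_eq hH hconn (by simp) hfreq
    (show -z ∈ {w : ℂ | w.re < 0} by simpa using hz)
  rw [hmgf] at h
  simpa using h

theorem norm_one_sub_cexp_neg_le_two {w : ℂ} (hw : 0 ≤ w.re) :
    ‖1 - Complex.exp (-w)‖ ≤ 2 := by
  refine (norm_sub_le _ _).trans ?_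
  have : Real.exp (-w.re) ≤ 1 := Real.exp_le_one_iff.2 (by linarith)
  rw [Complex.norm_exp, norm_one, Complex.neg_re]
  linarith

theorem norm_one_sub_cexp_neg_le_s4 {w : ℂ} (hw : 0 ≤ w.re) :
    ‖1 - Complex.exp (-w)‖ ≤ 2 * ‖w‖ := by
  rcases le_total ‖w‖ 1 with h | h
  · rw [norm_sub_rev, ← norm_neg w]
    exact Complex.norm_exp_sub_one_le (by rwa [norm_neg])
  · linarith [norm_one_sub_cexp_neg_le_two hw]

theorem integrableOn_one_sub_cexp_neg_mul_rpow {s : ℝ} (hs : 0 < s) (hs1 : s < 1) {z : ℂ}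
    (hz : 0 < z.re) :
    IntegrableOn (fun u : ℝ ↦ (1 - Complex.exp (-(z * u))) * ((u ^ (-1 - s) : ℝ) : ℂ))
      (Ioi 0) := by
  have hre {u : ℝ} (hu : 0 < u) : 0 ≤ (z * u).re := by simpa using (mul_pos hz hu).le
  rw [← Ioc_union_Ioi_eq_Ioi zero_le_one]
  refine IntegrableOn.union ?_ ?_
  · have h : IntegrableOn (fun u : ℝ ↦ 2 * ‖z‖ * u ^ (-s)) (Ioc 0 1) := by
      refine Integrable.const_mul ?_ _
      exact (intervalIntegrable_iff_integrableOn_Ioc_of_le zero_le_one).1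
        (intervalIntegral.intervalIntegrable_rpow' (by linarith))
    refine Integrable.mono' h (by fun_prop) ?_
    refine ae_restrict_of_forall_mem measurableSet_Ioc fun u hu ↦ ?_
    have hu' : 0 < u := hu.1
    rw [norm_mul, Complex.norm_real, Real.norm_of_nonneg (by positivity)]
    calc _ ≤ 2 * ‖z * u‖ * u ^ (-1 - s) := by
          gcongr
          exact norm_one_sub_cexp_neg_le_s4 (hre hu')
      _ = 2 * ‖z‖ * (u ^ (1 : ℝ) * u ^ (-1 - s)) := by
          rw [norm_mul, Complex.norm_real, Real.norm_of_nonneg hu'.le, rpow_one]; ring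
      _ = _ := by rw [← rpow_add hu']; ring_nf
  · have h : IntegrableOn (fun u : ℝ ↦ 2 * u ^ (-1 - s)) (Ioi 1) :=
      (integrableOn_Ioi_rpow_of_lt (by linarith) one_pos).const_mul _
    refine Integrable.mono' h (by fun_prop) ?_
    refine ae_restrict_of_forall_mem measurableSet_Ioi fun u hu ↦ ?_
    have hu' : 0 < u := one_pos.trans hu
    rw [norm_mul, Complex.norm_real, Real.norm_of_nonneg (by positivity)]
    gcongr
    exact norm_one_sub_cexp_neg_le_two (hre hu')

theorem integral_one_sub_cexp_neg_mul_rpow {s : ℝ} (hs : 0 < s) (hs1 : s < 1) {z : ℂ}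
    (hz : 0 < z.re) :
    ∫ u in Ioi (0 : ℝ), (1 - Complex.exp (-(z * u))) * ((u ^ (-1 - s) : ℝ) : ℂ) =
      -((Real.Gamma (-s) : ℂ) * z ^ (s : ℂ)) := by
  have hs0 : (s : ℂ) ≠ 0 := by exact_mod_cast hs.ne'
  have hz0 : z ≠ 0 := by rintro rfl; simp at hz
  have hre {u : ℝ} (hu : 0 < u) : 0 ≤ (z * u).re := by simpa using (mul_pos hz hu).le
  have hvnorm {u : ℝ} (hu : 0 < u) :
      ‖((-(u ^ (-s)) / s : ℝ) : ℂ)‖ = u ^ (-s) / s := by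
    rw [Complex.norm_real, norm_div, norm_neg, Real.norm_of_nonneg (by positivity),
      Real.norm_of_nonneg hs.le]
  have hu : ∀ x ∈ Ioi (0 : ℝ), HasDerivAt (fun u : ℝ ↦ 1 - Complex.exp (-(z * u)))
      (z * Complex.exp (-(z * x))) x := by
    intro x _
    have h : HasDerivAt (fun u : ℝ ↦ -(z * (u : ℂ))) (-(z * 1)) x :=
      ((Complex.ofRealCLM.hasDerivAt (x := x)).const_mul z).neg
    exact (h.cexp.const_sub 1).congr_deriv (by ring)
  have hv : ∀ x ∈ Ioi (0 : ℝ), HasDerivAt (fun u : ℝ ↦ ((-(u ^ (-s)) / s : ℝ) : ℂ))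
      ((x ^ (-1 - s) : ℝ) : ℂ) x := by
    intro x hx
    have h := (((Real.hasDerivAt_rpow_const (p := -s) (Or.inl (ne_of_gt hx))).neg).div_const
      s).ofReal_comp
    refine h.congr_deriv ?_
    rw [show -s - 1 = -1 - s by ring]
    congr 1
    field_simp
  have hgamma := integrableOn_rpow_mul_cexp_neg_mul (a := 1 - s) (by linarith) hz
  have heq (u : ℝ) : z * Complex.exp (-(z * u)) * ((-(u ^ (-s)) / s : ℝ) : ℂ) =
      -(z / s) * (((u ^ (1 - s - 1) : ℝ) : ℂ) * Complex.exp (-(z * u))) := by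
    rw [show 1 - s - 1 = -s by ring]
    push_cast
    ring
  have hzero : Tendsto ((fun u : ℝ ↦ 1 - Complex.exp (-(z * u))) *
      fun u : ℝ ↦ ((-(u ^ (-s)) / s : ℝ) : ℂ)) (𝓝[>] 0) (𝓝 0) := by
    have h : Tendsto (fun u : ℝ ↦ 2 * ‖z‖ / s * u ^ (1 - s)) (𝓝[>] 0) (𝓝 0) := by
      have := ((continuousAt_rpow_const 0 (1 - s) (Or.inr (by linarith))).tendsto.const_mul
        (2 * ‖z‖ / s)).mono_left (nhdsWithin_le_nhds (s := Ioi 0))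
      simpa [zero_rpow (by linarith : 1 - s ≠ 0)] using this
    refine squeeze_zero_norm' ?_ h
    filter_upwards [self_mem_nhdsWithin] with u hu
    have hu' : 0 < u := hu
    rw [Pi.mul_apply, norm_mul, hvnorm hu']
    calc _ ≤ 2 * ‖z * u‖ * (u ^ (-s) / s) := by
          gcongr
          exact norm_one_sub_cexp_neg_le_s4 (hre hu')
      _ = 2 * ‖z‖ / s * (u ^ (1 : ℝ) * u ^ (-s)) := by
          rw [norm_mul, Complex.norm_real, Real.norm_of_nonneg hu'.le, rpow_one]; ring
      _ = _ := by rw [← rpow_add hu']; ring_nf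
  have hinfty : Tendsto ((fun u : ℝ ↦ 1 - Complex.exp (-(z * u))) *
      fun u : ℝ ↦ ((-(u ^ (-s)) / s : ℝ) : ℂ)) atTop (𝓝 0) := by
    have h : Tendsto (fun u : ℝ ↦ 2 * (u ^ (-s) / s)) atTop (𝓝 0) := by
      simpa using ((tendsto_rpow_neg_atTop hs).div_const s).const_mul 2
    refine squeeze_zero_norm' ?_ h
    filter_upwards [eventually_gt_atTop 0] with u hu'
    rw [Pi.mul_apply, norm_mul, hvnorm hu']
    gcongr
    exact norm_one_sub_cexp_neg_le_two (hre hu')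
  rw [integral_Ioi_mul_deriv_eq_deriv_mul hu hv
    (integrableOn_one_sub_cexp_neg_mul_rpow hs hs1 hz)
    ((hgamma.const_mul (-(z / s))).congr (ae_of_all _ fun u ↦ (heq u).symm)) hzero hinfty]
  simp_rw [heq]
  rw [integral_const_mul, integral_rpow_mul_cexp_neg_mul_Ioi (by linarith) hz,
    show 1 - s = -s + 1 by ring, Real.Gamma_add_one (by linarith : -s ≠ 0)]
  have hpow : z ^ (s : ℂ) = z ^ (-((-s + 1 : ℝ) : ℂ)) * z := by
    nth_rewrite 3 [← Complex.cpow_one z]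
    rw [← Complex.cpow_add _ _ hz0]
    push_cast
    ring_nf
  rw [hpow]
  push_cast
  field_simp
  ring

/-- with `B = Γ(1−α)cos(πα/2)` and `C = Γ(1−α)sin(πα/2)`, for `1 < α < 2`
and `0 < r < α`,
`∫₀^∞ (1 − e^{−Bu} cos(Cu)) u^{−1−r/α} du = −Γ(−r/α)|Γ(1−α)|^{r/α} cos(πr/2 − πr/α)`. -/
theorem stable_integral_identity (α r : ℝ) (hα : 1 < α) (hα2 : α < 2)
    (hr : 0 < r) (hrα : r < α) :
    ∫ u in Set.Ioi (0:ℝ),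
        (1 - Real.exp (-(Real.Gamma (1 - α) * Real.cos (π * α / 2) * u)) *
            Real.cos (Real.Gamma (1 - α) * Real.sin (π * α / 2) * u)) *
          u ^ (-1 - r / α) =
      -(Real.Gamma (-(r / α)) * |Real.Gamma (1 - α)| ^ (r / α) *
        Real.cos (π * r / 2 - π * r / α)) := by
  have hα0 : 0 < α := by linarith
  have hs : 0 < r / α := div_pos hr hα0
  have hs1 : r / α < 1 := (div_lt_one hα0).2 hrα
  have hΓ : Real.Gamma (1 - α) < 0 := by
    have h := Real.Gamma_add_one (by linarith : 1 - α ≠ 0)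
    have h' := Real.Gamma_pos_of_pos (by linarith : 0 < 1 - α + 1)
    nlinarith
  set G := Real.Gamma (1 - α)
  set θ := π * α / 2 - π with hθ
  have hcos : Real.cos (π * α / 2) = -Real.cos θ := by rw [hθ, Real.cos_sub_pi, neg_neg]
  have hsin : Real.sin (π * α / 2) = -Real.sin θ := by rw [hθ, Real.sin_sub_pi, neg_neg]
  have hθ1 : -(π / 2) < θ := by nlinarith [pi_pos]
  have hθ2 : θ < 0 := by nlinarith [pi_pos]
  set z : ℂ := ((-G : ℝ) : ℂ) * (Complex.cos θ + Complex.sin θ * Complex.I) with hz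
  have hzre : z.re = G * Real.cos (π * α / 2) := by
    rw [hz, Complex.re_ofReal_mul, hcos, ← Complex.ofReal_cos, ← Complex.ofReal_sin]
    simp [-Complex.ofReal_cos, -Complex.ofReal_sin]
  have hzim : z.im = G * Real.sin (π * α / 2) := by
    rw [hz, Complex.im_ofReal_mul, hsin, ← Complex.ofReal_cos, ← Complex.ofReal_sin]
    simp [-Complex.ofReal_cos, -Complex.ofReal_sin]
  have hzpos : 0 < z.re := by
    rw [hzre, hcos]
    have := Real.cos_pos_of_mem_Ioo ⟨hθ1, hθ2.trans (by positivity)⟩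
    nlinarith
  have harg : z.arg = θ :=
    Complex.arg_mul_cos_add_sin_mul_I (neg_pos.2 hΓ) ⟨by linarith [pi_pos], by linarith [pi_pos]⟩
  have hnorm : ‖z‖ = |G| := by
    rw [hz, norm_mul, Complex.norm_cos_add_sin_mul_I, Complex.norm_real, norm_neg, mul_one,
      Real.norm_eq_abs]
  rw [← hzre, ← hzim]
  have h := congrArg Complex.re (integral_one_sub_cexp_neg_mul_rpow hs hs1 hzpos)
  rw [← RCLike.re_eq_complex_re,
    ← integral_re (integrableOn_one_sub_cexp_neg_mul_rpow hs hs1 hzpos)] at h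
  simp only [RCLike.re_eq_complex_re, Complex.re_mul_ofReal, Complex.sub_re, Complex.one_re,
    Complex.exp_re, Complex.neg_re, Complex.neg_im, Complex.im_mul_ofReal, Real.cos_neg,
    Complex.re_ofReal_mul, Complex.cpow_ofReal_re, hnorm, harg] at h
  rw [h, mul_assoc, hθ]
  congr 4
  field_simp
end
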